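/- arXiv:0806.4398 — 2 statements merged into one kernel-verified Lean document; each statement's English description precedes it below -/
import Mathlib

section
/- Let k be an even integer, N ≥ 1 an integer, and ε ∈ SL₂(ℝ) with ε^N = I or ε^N = -I. Let f : ℍ → ℂ be any function and set g := f|ₖε − f. If g|ₖε = g, then g = 0; that is, f|ₖε = f. -/
open UpperHalfPlane

/-- The weight-`k` slash action of `SL(2, ℝ)` on functions `ℍ → ℂ`:
`(f ∣[k] γ)(z) = (c z + d)^(-k) · f(γ z)`. -/
noncomputable def slash (k : ℤ) (γ : Matrix.SpecialLinearGroup (Fin 2) ℝ)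
    (f : UpperHalfPlane → ℂ) : UpperHalfPlane → ℂ :=
  fun z =>
    (((↑γ : Matrix (Fin 2) (Fin 2) ℝ) 1 0 : ℂ) * (z : ℂ)
        + ((↑γ : Matrix (Fin 2) (Fin 2) ℝ) 1 1 : ℂ)) ^ (-k) * f (γ • z)

open scoped ModularForm in
lemma slash_eq_modularForm_slash (k : ℤ) (γ : Matrix.SpecialLinearGroup (Fin 2) ℝ)
    (f : UpperHalfPlane → ℂ) :
    slash k γ f = f ∣[k] (γ : GL (Fin 2) ℝ) := by
  funext z
  simp only [slash, ModularForm.slash_apply]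
  simp only [σ, denom]
  simp [mul_comm]
  exact mul_comm _ _

lemma slash_mul (k : ℤ) (γ δ : Matrix.SpecialLinearGroup (Fin 2) ℝ)
    (f : UpperHalfPlane → ℂ) :
    slash k (γ * δ) f = slash k δ (slash k γ f) := by
  simp only [slash_eq_modularForm_slash, map_mul, SlashAction.slash_mul]

lemma slash_add (k : ℤ) (γ : Matrix.SpecialLinearGroup (Fin 2) ℝ)
    (f g : UpperHalfPlane → ℂ) :
    slash k γ (f + g) = slash k γ f + slash k γ g := by
  funext z
  simp [slash, mul_add]

lemma slash_one (k : ℤ) (f : UpperHalfPlane → ℂ) : slash k 1 f = f := by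
  funext z
  simp [slash]

lemma slash_neg_one {k : ℤ} (hk : Even k) (f : UpperHalfPlane → ℂ) :
    slash k (-1) f = f := by
  funext z
  simp [slash, hk.neg_one_zpow]
  congr 1
  ext1
  simp [specialLinearGroup_apply]

lemma slash_pow_eq_add_nsmul {k : ℤ} {γ : Matrix.SpecialLinearGroup (Fin 2) ℝ}
    {f g : UpperHalfPlane → ℂ} (hf : slash k γ f = f + g) (hg : slash k γ g = g) (n : ℕ) :
    slash k (γ ^ n) f = f + n • g := by
  have hgn : ∀ m : ℕ, slash k (γ ^ m) g = g := fun m => by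
    induction m with
    | zero => simp [slash_one]
    | succ m ih => rw [pow_succ, slash_mul, ih, hg]
  induction n with
  | zero => simp [slash_one]
  | succ n ih => rw [pow_succ', slash_mul, hf, slash_add, ih, hgn, succ_nsmul, add_assoc]

/-- Let `k` be even, `N ≥ 1`, and `ε ∈ SL₂(ℝ)` with `ε^N = ±I`. If
`g := f∣[k]ε − f` satisfies `g∣[k]ε = g`, then `g = 0`, i.e. `f∣[k]ε = f`. -/
theorem elliptic_invariance (k : ℤ) (hk : Even k) (N : ℕ) (hN : 1 ≤ N)
    (ε : Matrix.SpecialLinearGroup (Fin 2) ℝ)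
    (hε : (↑(ε ^ N) : Matrix (Fin 2) (Fin 2) ℝ) = 1 ∨
          (↑(ε ^ N) : Matrix (Fin 2) (Fin 2) ℝ) = -1)
    (f g : UpperHalfPlane → ℂ)
    (hg : g = slash k ε f - f)
    (hinv : slash k ε g = g) :
    g = 0 := by
  have hpow := slash_pow_eq_add_nsmul (f := f) (by rw [hg]; abel) hinv N
  have hfix : slash k (ε ^ N) f = f := by
    rcases hε with h | h
    · rw [show ε ^ N = 1 from Subtype.ext h, slash_one]
    · rw [show ε ^ N = -1 from Subtype.ext h, slash_neg_one hk]
  rw [hfix, left_eq_add] at hpow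
  exact (smul_eq_zero.mp hpow).resolve_left (by omega)
end

section
/- Let k ≥ 4 be an even integer, z₀ = α + iβ ∈ ℍ (β > 0), and let f : ℍ → ℂ be holomorphic. Define g on the open unit disc 𝔻 = {w ∈ ℂ : |w| < 1} by g(w) := (2iβ)^{k/2} (1−w)^{-k} f((z₀ − conj(z₀)·w)/(1−w)). Then g is holomorphic on 𝔻 and for every integer m ≥ 0 its m-th Taylor coefficient at 0 is g^{(m)}(0)/m! = Σ_{r=0}^{m} C(m+k−1, r+k−1) · (2iβ)^{r+k/2} · f^{(r)}(z₀)/r!, where C(·,·) denotes the binomial coefficient and f^{(r)} the r-th complex derivative. -/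
open Complex

/-- The coefficient `(m! / r!) * C(m + K, r + K)` of the `r`-th derivative in the `m`-th derivative
of `w ↦ (1 - w)⁻¹ ^ (K + 1) * f ((a - b * w) / (1 - w))`. -/
noncomputable def moebiusCoeff (K m r : ℕ) : ℂ :=
  m.factorial * (m + K).choose (r + K) / r.factorial

theorem moebiusCoeff_of_lt (K : ℕ) {m r : ℕ} (h : m < r) : moebiusCoeff K m r = 0 := by
  simp [moebiusCoeff, Nat.choose_eq_zero_of_lt (show m + K < r + K by lia)]

theorem moebiusCoeff_succ_zero (K m : ℕ) :
    moebiusCoeff K (m + 1) 0 = (K + 1 + m) * moebiusCoeff K m 0 := by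
  have h : ((m + 1 : ℕ) : ℂ) * (m + 1 + K).choose K = (K + 1 + m) * (m + K).choose K := by
    have h := Nat.choose_mul_succ_eq (m + K) K
    rw [show m + K + 1 - K = m + 1 by lia, show m + K + 1 = m + 1 + K by lia] at h
    have h' : ((m + K).choose K : ℂ) * (m + 1 + K : ℕ) = (m + 1 + K).choose K * (m + 1 : ℕ) := by
      exact_mod_cast h
    push_cast at h' ⊢
    linear_combination -h'
  simp only [moebiusCoeff, Nat.factorial_succ, Nat.cast_mul, zero_add, Nat.factorial_zero,
    Nat.cast_one, div_one]
  linear_combination (m.factorial : ℂ) * h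

theorem moebiusCoeff_succ_succ (K : ℕ) {m r : ℕ} (hr : r ≤ m) :
    moebiusCoeff K (m + 1) (r + 1) =
      (K + 1 + m + (r + 1)) * moebiusCoeff K m (r + 1) + moebiusCoeff K m r := by
  have h : ((m + K).choose (r + K + 1) : ℂ) * (r + K + 1) = (m + K).choose (r + K) * (m - r) := by
    have h := Nat.choose_succ_right_eq (m + K) (r + K)
    rw [show m + K - (r + K) = m - r by lia] at h
    rw [← Nat.cast_sub hr]
    exact_mod_cast h
  have hp : ((m + 1 + K).choose (r + K + 1) : ℂ) =
      (m + K).choose (r + K) + (m + K).choose (r + K + 1) := by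
    rw [show m + 1 + K = m + K + 1 by lia, Nat.choose_succ_succ]
    push_cast
    rfl
  have h0 : (r.factorial : ℂ) ≠ 0 := by exact_mod_cast r.factorial_ne_zero
  have h1 : (r + 1 : ℂ) ≠ 0 := by exact_mod_cast r.succ_ne_zero
  simp only [moebiusCoeff, show r + 1 + K = r + K + 1 by lia, hp, Nat.factorial_succ, Nat.cast_mul]
  push_cast
  field_simp
  linear_combination -(m.factorial : ℂ) * h

theorem hasDerivAt_moebius (a b : ℂ) {w : ℂ} (hw : 1 - w ≠ 0) :
    HasDerivAt (fun w : ℂ => (a - b * w) / (1 - w)) ((a - b) * ((1 - w) ^ 2)⁻¹) w := by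
  have h := (((hasDerivAt_id w).const_mul b).const_sub a).div ((hasDerivAt_id w).const_sub 1) hw
  refine h.congr_deriv ?_
  simp only [id]
  field_simp
  ring

theorem hasDerivAt_inv_one_sub_pow (n : ℕ) {w : ℂ} (hw : 1 - w ≠ 0) :
    HasDerivAt (fun w : ℂ => ((1 - w) ^ n)⁻¹) (n * ((1 - w) ^ (n + 1))⁻¹) w := by
  have h := (((hasDerivAt_id w).const_sub 1).fun_pow n).fun_inv (pow_ne_zero n hw)
  refine h.congr_deriv ?_
  simp only [id]
  cases n with
  | zero => simp
  | succ n =>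
    simp only [Nat.add_sub_cancel]
    field_simp
    ring

theorem DifferentiableOn.hasDerivAt_iteratedDeriv {f : ℂ → ℂ} {U : Set ℂ} (hU : IsOpen U)
    (hf : DifferentiableOn ℂ f U) (r : ℕ) {z : ℂ} (hz : z ∈ U) :
    HasDerivAt (iteratedDeriv r f) (iteratedDeriv (r + 1) f z) z := by
  rw [iteratedDeriv_succ]
  rw [iteratedDeriv_eq_iterate]
  exact ((hf.analyticAt (hU.mem_nhds hz)).iterated_deriv r).differentiableAt.hasDerivAt

theorem iteratedDeriv_moebius_weight {f : ℂ → ℂ} {U V : Set ℂ} (hU : IsOpen U) (hV : IsOpen V)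
    (hf : DifferentiableOn ℂ f U) (a b : ℂ) (hV1 : ∀ w ∈ V, 1 - w ≠ 0)
    (hVU : ∀ w ∈ V, (a - b * w) / (1 - w) ∈ U) (K m : ℕ) {w : ℂ} (hw : w ∈ V) :
    iteratedDeriv m (fun w : ℂ => ((1 - w) ^ (K + 1))⁻¹ * f ((a - b * w) / (1 - w))) w =
      ∑ r ∈ Finset.range (m + 1), moebiusCoeff K m r * ((a - b) ^ r *
        (((1 - w) ^ (K + 1 + m + r))⁻¹ * iteratedDeriv r f ((a - b * w) / (1 - w)))) := by
  induction m generalizing w with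
  | zero => simp [moebiusCoeff]
  | succ m ih =>
    have hev := Filter.eventuallyEq_of_mem (hV.mem_nhds hw) fun x hx => ih hx
    rw [iteratedDeriv_succ, hev.deriv_eq]
    have hsum := HasDerivAt.fun_sum (u := Finset.range (m + 1)) fun r _ =>
      ((((hasDerivAt_inv_one_sub_pow (K + 1 + m + r) (hV1 w hw)).mul
        ((hf.hasDerivAt_iteratedDeriv hU r (hVU w hw)).comp w
          (hasDerivAt_moebius a b (hV1 w hw)))).const_mul ((a - b) ^ r)).const_mul
            (moebiusCoeff K m r))
    refine hsum.deriv.trans ?_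
    set t : ℕ → ℂ := fun r => (a - b) ^ r * (((1 - w) ^ (K + 1 + (m + 1) + r))⁻¹ *
      iteratedDeriv r f ((a - b * w) / (1 - w))) with ht
    have hterm : ∀ r ∈ Finset.range (m + 1), moebiusCoeff K m r * ((a - b) ^ r *
        (((K + 1 + m + r : ℕ) : ℂ) * ((1 - w) ^ (K + 1 + m + r + 1))⁻¹ *
          iteratedDeriv r f ((a - b * w) / (1 - w)) + ((1 - w) ^ (K + 1 + m + r))⁻¹ *
          (iteratedDeriv (r + 1) f ((a - b * w) / (1 - w)) * ((a - b) * ((1 - w) ^ 2)⁻¹)))) =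
        (K + 1 + m + r) * moebiusCoeff K m r * t r + moebiusCoeff K m r * t (r + 1) := by
      intro r _
      have hw1 := hV1 w hw
      simp only [ht, show K + 1 + (m + 1) + r = K + 1 + m + r + 1 by lia,
        show K + 1 + (m + 1) + (r + 1) = K + 1 + m + r + 2 by lia, pow_add _ (K + 1 + m + r),
        mul_inv]
      push_cast
      ring
    refine (Finset.sum_congr rfl hterm).trans ?_
    have hlast : ∑ r ∈ Finset.range (m + 1), (K + 1 + m + r : ℂ) * moebiusCoeff K m r * t r =
        ∑ r ∈ Finset.range (m + 2), (K + 1 + m + r : ℂ) * moebiusCoeff K m r * t r := by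
      simp [Finset.sum_range_succ _ (m + 1), moebiusCoeff_of_lt K m.lt_succ_self]
    rw [Finset.sum_add_distrib, hlast, Finset.sum_range_succ', Finset.sum_range_succ' _ (m + 1),
      moebiusCoeff_succ_zero, add_right_comm, ← Finset.sum_add_distrib]
    congr 1
    · refine Finset.sum_congr rfl fun r hr => ?_
      rw [moebiusCoeff_succ_succ K (Finset.mem_range_succ_iff.mp hr)]
      push_cast
      ring
    · simp [ht]

theorem im_moebius_pos {z w : ℂ} (hz : 0 < z.im) (hw : w ∈ Metric.ball (0 : ℂ) 1) :
    0 < ((z - starRingEnd ℂ z * w) / (1 - w)).im := by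
  have hlt : w.re * w.re + w.im * w.im < 1 := by
    rw [← normSq_apply, normSq_eq_norm_sq]
    exact pow_lt_one₀ (norm_nonneg w) (mem_ball_zero_iff.mp hw) two_ne_zero
  have hN : 0 < normSq (1 - w) := by
    refine normSq_pos.mpr (sub_ne_zero.mpr ?_)
    rintro rfl
    simp at hw
  have h : ((z - starRingEnd ℂ z * w) / (1 - w)).im =
      z.im * (1 - (w.re * w.re + w.im * w.im)) / normSq (1 - w) := by
    simp only [div_im, sub_im, sub_re, mul_im, mul_re, conj_re, conj_im, one_re, one_im]
    ring
  rw [h]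
  exact div_pos (mul_pos hz (sub_pos.mpr hlt)) hN

/-- For even `k ≥ 4`, `z₀ = α + iβ ∈ ℍ` and `f` holomorphic on the upper half-plane, the
function `g(w) := (2iβ)^{k/2} (1−w)^{-k} f((z₀ − conj(z₀)w)/(1−w))` is holomorphic on the
open unit disc and its Taylor coefficients at `0` are
`g^{(m)}(0)/m! = Σ_{r=0}^m C(m+k−1, r+k−1)·(2iβ)^{r+k/2}·f^{(r)}(z₀)/r!`. -/
theorem elliptic_vs_taylor_coefficients (k : ℕ) (hk : 4 ≤ k) (hke : Even k)
    (α β : ℝ) (hβ : 0 < β) (z₀ : ℂ) (hz₀ : z₀ = α + β * Complex.I)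
    (f : ℂ → ℂ) (hf : DifferentiableOn ℂ f {z : ℂ | 0 < z.im})
    (g : ℂ → ℂ)
    (hg : g = fun w : ℂ =>
      (2 * Complex.I * β) ^ (k / 2) * (1 - w) ^ (-(k : ℤ))
        * f ((z₀ - (starRingEnd ℂ z₀) * w) / (1 - w))) :
    DifferentiableOn ℂ g (Metric.ball (0 : ℂ) 1) ∧
    ∀ m : ℕ, iteratedDeriv m g 0 / (Nat.factorial m : ℂ) =
      ∑ r ∈ Finset.range (m + 1),
        (Nat.choose (m + k - 1) (r + k - 1) : ℂ) * (2 * Complex.I * β) ^ (r + k / 2)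
          * iteratedDeriv r f z₀ / (Nat.factorial r : ℂ) := by
  have hU : IsOpen {z : ℂ | 0 < z.im} := isOpen_lt continuous_const continuous_im
  have him : z₀.im = β := by simp [hz₀]
  have hc : z₀ - starRingEnd ℂ z₀ = 2 * Complex.I * β := by
    rw [sub_conj, him]
    push_cast
    ring
  have h1 : ∀ w ∈ Metric.ball (0 : ℂ) 1, 1 - w ≠ 0 := by
    intro w hw h
    obtain rfl := sub_eq_zero.mp h
    simp at hw
  have hmaps : ∀ w ∈ Metric.ball (0 : ℂ) 1,
      (z₀ - starRingEnd ℂ z₀ * w) / (1 - w) ∈ {z : ℂ | 0 < z.im} :=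
    fun w hw => im_moebius_pos (him ▸ hβ) hw
  obtain ⟨K, rfl⟩ : ∃ K, k = K + 1 := ⟨k - 1, by lia⟩
  have hg' : g = fun w : ℂ => (2 * Complex.I * β) ^ ((K + 1) / 2) *
      (((1 - w) ^ (K + 1))⁻¹ * f ((z₀ - starRingEnd ℂ z₀ * w) / (1 - w))) := by
    rw [hg]
    funext w
    rw [zpow_neg, zpow_natCast, mul_assoc]
  have hdiff : DifferentiableOn ℂ (fun w : ℂ => ((1 - w) ^ (K + 1))⁻¹ *
      f ((z₀ - starRingEnd ℂ z₀ * w) / (1 - w))) (Metric.ball 0 1) := fun w hw =>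
    ((hasDerivAt_inv_one_sub_pow (K + 1) (h1 w hw)).differentiableAt.mul
      ((hf.differentiableAt (hU.mem_nhds (hmaps w hw))).comp w
        (hasDerivAt_moebius _ _ (h1 w hw)).differentiableAt)).differentiableWithinAt
  have h0 : (0 : ℂ) ∈ Metric.ball (0 : ℂ) 1 := Metric.mem_ball_self one_pos
  refine ⟨hg' ▸ hdiff.const_mul _, fun m => ?_⟩
  have hcd : ContDiffAt ℂ m (fun w : ℂ => ((1 - w) ^ (K + 1))⁻¹ *
      f ((z₀ - starRingEnd ℂ z₀ * w) / (1 - w))) 0 :=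
    (hdiff.analyticAt (Metric.isOpen_ball.mem_nhds h0)).contDiffAt
  rw [hg', iteratedDeriv_const_mul _ hcd,
    iteratedDeriv_moebius_weight hU Metric.isOpen_ball hf _ _ h1 hmaps K m h0, Finset.mul_sum,
    Finset.sum_div, hc]
  refine Finset.sum_congr rfl fun r _ => ?_
  have hm : (m.factorial : ℂ) ≠ 0 := by exact_mod_cast m.factorial_ne_zero
  simp only [moebiusCoeff, mul_zero, sub_zero, one_pow, inv_one, div_one, one_mul, ← add_assoc,
    Nat.add_sub_cancel, pow_add]
  field_simp
end
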